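/- Let s ≥ 0 be an integer, X₀ ≠ 0 real with inf_{p∈ℤ}|Δ^TM_p| > 0, τ_u, τ_w > 0, and X₁ ∈ C^s([0,d]) a d-periodic function. Define the sequence (U_ℓ, W_ℓ), ℓ ≥ 0, by the TM recursion: U_ℓ − W_ℓ + (X₀/(ik₀))(σ̂_loc − σ̂_nloc ∂ₓ²)[τ_w J₀ W_ℓ] = δ_{ℓ,0} ξ − (X₁(x)/(ik₀))(σ̂_loc − σ̂_nloc ∂ₓ²)[τ_w J₀ W_{ℓ−1}] and τ_u G₀ U_ℓ + τ_w J₀ W_ℓ = −δ_{ℓ,0} τ_u ν, with W_{−1} ≡ 0, where ξ = −e^{iαx} and ν = iγ_{u,0} e^{iαx}. Then this recursion has a unique solution with U_ℓ ∈ H^{s+1} and W_ℓ ∈ H^{s+3} for every ℓ, and there exist constants C_U, C_W, C > 0 such that for every D > C·|X₁|_{C^s} one has ‖U_ℓ‖_{H^{s+1}} ≤ C_U D^ℓ and ‖W_ℓ‖_{H^{s+3}} ≤ C_W D^ℓ for all ℓ ≥ 0; in particular the series Σ_ℓ U_ℓ δ^ℓ and Σ_ℓ W_ℓ δ^ℓ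 converge in H^{s+1} and H^{s+3} respectively for δ·C·|X₁|_{C^s} < 1. -/

import Mathlib

open Real Complex

/-- The vertical wavenumber. -/
noncomputable def gamC (k a : ℝ) : ℂ :=
  if a ^ 2 ≤ k ^ 2 then ((Real.sqrt (k ^ 2 - a ^ 2) : ℝ) : ℂ)
  else Complex.I * ((Real.sqrt (a ^ 2 - k ^ 2) : ℝ) : ℂ)

/-- The transverse-magnetic determinant. -/
noncomputable def DeltaTM (d α ku kw k₀ X₀ τu τw : ℝ) (σl σn : ℂ) (p : ℤ) : ℂ :=
  -(τu : ℂ) * Complex.I * gamC ku (α + (2 * π / d) * p)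
    - (τw : ℂ) * Complex.I * gamC kw (α + (2 * π / d) * p)
    + (τu : ℂ) * (τw : ℂ) * (σl / (Complex.I * (k₀ : ℂ))) * (X₀ : ℂ) *
        gamC ku (α + (2 * π / d) * p) * gamC kw (α + (2 * π / d) * p)
    + (τu : ℂ) * (τw : ℂ) * (σn / (Complex.I * (k₀ : ℂ))) * (X₀ : ℂ) *
        gamC ku (α + (2 * π / d) * p) * gamC kw (α + (2 * π / d) * p) *
        ((((α + (2 * π / d) * p) ^ 2 : ℝ)) : ℂ)

/-- The `k`-th Fourier coefficient of the `d`-periodic envelope `X₁`. -/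
noncomputable def envCoeff (d : ℝ) (X : ℝ → ℝ) (k : ℤ) : ℂ :=
  (1 / (d : ℂ)) * ∫ x in (0 : ℝ)..d,
    (X x : ℂ) * Complex.exp (-Complex.I * (2 * π / d : ℝ) * (k : ℂ) * (x : ℂ))

/-- The Hölder norm `|X|_{C^s} = max_{0 ≤ ℓ ≤ s} sup_x |∂ₓ^ℓ X(x)|`. -/
noncomputable def holderNorm (s : ℕ) (X : ℝ → ℝ) : ℝ :=
  ⨆ (ℓ : Fin (s + 1)) (x : ℝ), |iteratedDeriv (ℓ : ℕ) X x|

/-- The squared periodic Sobolev norm `‖U‖²_{H^s} = Σ_p ⟨p⟩^{2s}|Û_p|²`. -/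
noncomputable def hnormSq (s : ℝ) (U : ℤ → ℂ) : ℝ :=
  ∑' p : ℤ, (1 + |(p : ℝ)| ^ 2) ^ s * ‖U p‖ ^ 2

/-- The TM HOPE recursion: at order `ℓ`, mode `p`:
`Û_{ℓ,p} + (−1 − (X₀/(ik₀))(σ̂_loc + σ̂_nloc α_p²)τ_w iγ_{w,p})Ŵ_{ℓ,p}
  = δ_{ℓ,0} ξ̂_p − (1/(ik₀)) [X₁ · ((σ̂_loc − σ̂_nloc ∂ₓ²)τ_w J₀ W_{ℓ−1})]ˆ_p` and
`−τ_u iγ_{u,p}Û_{ℓ,p} − τ_w iγ_{w,p}Ŵ_{ℓ,p} = −δ_{ℓ,0} τ_u ν̂_p`,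
with `ξ = −e^{iαx}`, `ν = iγ_{u,0}e^{iαx}`, and `W_{−1} ≡ 0`. -/
def tmRec (d α ku kw k₀ X₀ τu τw : ℝ) (σl σn : ℂ) (X₁ : ℝ → ℝ)
    (UW : ℕ → (ℤ → ℂ) × (ℤ → ℂ)) : Prop :=
  ∀ ℓ : ℕ, ∀ p : ℤ,
    ((UW ℓ).1 p + (-1 - ((X₀ : ℂ) / (Complex.I * (k₀ : ℂ))) *
        (σl + σn * ((((α + (2 * π / d) * p) ^ 2 : ℝ)) : ℂ)) * (τw : ℂ) *
        (Complex.I * gamC kw (α + (2 * π / d) * p))) * (UW ℓ).2 p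
      = if ℓ = 0 then (if p = 0 then (-1 : ℂ) else 0)
        else -(1 / (Complex.I * (k₀ : ℂ))) *
          ∑' q : ℤ, envCoeff d X₁ (p - q) *
            (σl + σn * ((((α + (2 * π / d) * q) ^ 2 : ℝ)) : ℂ)) * (τw : ℂ) *
            (-Complex.I * gamC kw (α + (2 * π / d) * q)) * (UW (ℓ - 1)).2 q) ∧
    (-(τu : ℂ) * Complex.I * gamC ku (α + (2 * π / d) * p) * (UW ℓ).1 p
      - (τw : ℂ) * Complex.I * gamC kw (α + (2 * π / d) * p) * (UW ℓ).2 p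
      = if ℓ = 0 then -(τu : ℂ) * (if p = 0 then Complex.I * gamC ku α else 0) else 0)

section Helpers

open MeasureTheory Filter Topology

/-- The Japanese bracket `⟨p⟩`. -/
noncomputable def jap (p : ℤ) : ℝ := Real.sqrt (1 + (p : ℝ) ^ 2)

/-- The Sobolev norm `‖V‖_{H^s}` of integer order, with values in `[0, ∞]`. -/
noncomputable def sobNorm (s : ℕ) (V : ℤ → ℂ) : ENNReal :=
  eLpNorm (fun p => (jap p ^ s : ℝ) • V p) 2 Measure.count

/-- The Fourier coefficients of the product of two functions with coefficients `c` and `V`. -/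
noncomputable def conv (c V : ℤ → ℂ) (p : ℤ) : ℂ := ∑' q : ℤ, c (p - q) * V q

lemma jap_sq (p : ℤ) : jap p ^ 2 = 1 + (p : ℝ) ^ 2 := Real.sq_sqrt (by positivity)

lemma one_le_jap (p : ℤ) : 1 ≤ jap p := by
  rw [jap, Real.one_le_sqrt]; nlinarith [sq_nonneg (p : ℝ)]

lemma jap_pos (p : ℤ) : 0 < jap p := one_pos.trans_le (one_le_jap p)

lemma abs_le_jap (p : ℤ) : |(p : ℝ)| ≤ jap p :=
  Real.abs_le_sqrt (by linarith)

lemma eLpNorm_two_count (f : ℤ → ℂ) :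
    eLpNorm f 2 Measure.count = (∑' p, ENNReal.ofReal (‖f p‖ ^ 2)) ^ (1 / 2 : ℝ) := by
  rw [eLpNorm_eq_lintegral_rpow_enorm_toReal (by norm_num) (by norm_num), lintegral_count]
  simp [ENNReal.ofReal_pow]

lemma eLpNorm_two_count_ne_top {f : ℤ → ℂ} :
    eLpNorm f 2 Measure.count ≠ ⊤ ↔ Summable fun p => ‖f p‖ ^ 2 := by
  rw [eLpNorm_two_count]
  simp only [ne_eq, ENNReal.rpow_eq_top_iff_of_pos (show (0 : ℝ) < 1 / 2 by norm_num)]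
  refine ⟨fun h => ?_, fun h => h.tsum_ofReal_ne_top⟩
  simpa [ENNReal.toReal_ofReal] using ENNReal.summable_toReal h

lemma toReal_eLpNorm_two_count {f : ℤ → ℂ} :
    (eLpNorm f 2 Measure.count).toReal = Real.sqrt (∑' p, ‖f p‖ ^ 2) := by
  by_cases h : Summable fun p => ‖f p‖ ^ 2
  · rw [eLpNorm_two_count, ← ENNReal.ofReal_tsum_of_nonneg (fun _ => by positivity) h,
      ENNReal.ofReal_rpow_of_nonneg (tsum_nonneg fun _ => by positivity) (by norm_num),
      ENNReal.toReal_ofReal (by positivity), Real.sqrt_eq_rpow]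
  · rw [tsum_eq_zero_of_not_summable h, Real.sqrt_zero]
    rw [← eLpNorm_two_count_ne_top, not_not] at h
    simp [h]

lemma eLpNorm_fourierBasis_repr {T : ℝ} [Fact (0 < T)]
    (u : Lp ℂ 2 (@AddCircle.haarAddCircle T _)) :
    eLpNorm (fun p => fourierBasis.repr u p) 2 Measure.count
      = eLpNorm u 2 AddCircle.haarAddCircle := by
  have hs : Summable fun p => ‖fourierBasis.repr u p‖ ^ 2 := by
    simpa using (memℓp_gen_iff (by norm_num)).1 (lp.memℓp (fourierBasis.repr u))
  rw [← ENNReal.toReal_eq_toReal_iff' (eLpNorm_two_count_ne_top.2 hs) (Lp.eLpNorm_ne_top u),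
    toReal_eLpNorm_two_count, ← Lp.norm_def, ← (fourierBasis (T := T)).repr.norm_map u]
  have h := lp.norm_rpow_eq_tsum (p := 2) (by norm_num) (fourierBasis.repr u)
  simp only [ENNReal.toReal_ofNat, Real.rpow_ofNat] at h
  rw [← h, Real.sqrt_sq (norm_nonneg _)]

/-- Multiplication by a continuous function on the circle, in terms of Fourier coefficients. -/
lemma hasSum_fourierCoeff_mul {T : ℝ} [Fact (0 < T)] (g : C(AddCircle T, ℂ))
    (v : Lp ℂ 2 (@AddCircle.haarAddCircle T _)) (p : ℤ) :
    HasSum (fun q => fourierCoeff g (p - q) * fourierBasis.repr v q)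
      (fourierCoeff (fun x => g x * v x) p) := by
  let h : C(AddCircle T, ℂ) := fourier p * star g
  let hL : Lp ℂ 2 (@AddCircle.haarAddCircle T _) :=
    ContinuousMap.toLp 2 AddCircle.haarAddCircle ℂ h
  have hcoe : hL =ᵐ[AddCircle.haarAddCircle] h := ContinuousMap.coeFn_toLp _ _
  convert! fourierBasis.hasSum_inner_mul_inner hL v using 1
  · ext q
    rw [HilbertBasis.repr_apply_apply]
    congr 1
    rw [L2.inner_def, coe_fourierBasis]
    apply integral_congr_ae
    filter_upwards [hcoe, coeFn_fourierLp 2 q] with x hx hq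
    rw [hx, hq]
    have : -(p - q) = -p + q := by ring
    simp only [h, this, fourier_add, RCLike.inner_apply', ContinuousMap.mul_apply, map_mul,
      ContinuousMap.star_apply, smul_eq_mul, fourier_neg]
    simp
    ring
  · rw [L2.inner_def]
    apply integral_congr_ae
    filter_upwards [hcoe] with x hx
    rw [hx]
    simp only [h, RCLike.inner_apply', ContinuousMap.mul_apply, map_mul,
      ContinuousMap.star_apply, smul_eq_mul, fourier_neg]
    simp
    ring

lemma conv_fourierCoeff_bound {T : ℝ} [Fact (0 < T)] (g : C(AddCircle T, ℂ)) {M : ℝ}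
    (hM : ∀ x, ‖g x‖ ≤ M) {V : ℤ → ℂ} (hV : eLpNorm V 2 Measure.count ≠ ⊤) :
    (∀ p, Summable fun q => fourierCoeff g (p - q) * V q) ∧
      eLpNorm (conv (fourierCoeff g) V) 2 Measure.count
        ≤ ENNReal.ofReal M * eLpNorm V 2 Measure.count := by
  have hV' : Memℓp V 2 := (memℓp_gen_iff (by norm_num)).2 (by
    simpa using eLpNorm_two_count_ne_top.1 hV)
  obtain ⟨v, hv⟩ := (fourierBasis (T := T)).repr.surjective ⟨V, hV'⟩
  have hvV : (fun p => fourierBasis.repr v p) = V := by rw [hv]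
  have key := hasSum_fourierCoeff_mul g v
  have hle : ∀ᵐ x ∂AddCircle.haarAddCircle, ‖g x * v x‖ ≤ M * ‖v x‖ := by
    refine ae_of_all _ fun x => ?_
    rw [norm_mul]
    gcongr
    exact hM x
  have hmem : MemLp (fun x => g x * v x) 2 AddCircle.haarAddCircle :=
    (Lp.memLp v).of_le_mul
      (g.continuous.aestronglyMeasurable.mul (Lp.aestronglyMeasurable v)) hle
  have hconv : conv (fourierCoeff g) V = fun p => fourierBasis.repr hmem.toLp p := by
    ext p
    rw [fourierBasis_repr, fourierCoeff_congr_ae hmem.coeFn_toLp, ← (key p).tsum_eq, hv]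
    rfl
  refine ⟨fun p => ?_, ?_⟩
  · simpa [hv] using (key p).summable
  · rw [hconv, eLpNorm_fourierBasis_repr, eLpNorm_congr_ae hmem.coeFn_toLp]
    conv_rhs => rw [← hvV, eLpNorm_fourierBasis_repr]
    exact eLpNorm_le_mul_eLpNorm_of_ae_le_mul hle 2

/-- A continuous periodic real function, as a complex function on the circle. -/
noncomputable def circleLift {d : ℝ} {X : ℝ → ℝ} (hX : Continuous X)
    (hper : Function.Periodic X d) : C(AddCircle d, ℂ) where
  toFun x := (hper.lift x : ℂ)
  continuous_toFun := Complex.continuous_ofReal.comp (continuous_coinduced_dom.2 hX)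

lemma fourierCoeff_circleLift {d : ℝ} [Fact (0 < d)] {X : ℝ → ℝ} (hX : Continuous X)
    (hper : Function.Periodic X d) : fourierCoeff (circleLift hX hper) = envCoeff d X := by
  ext k
  rw [fourierCoeff_eq_intervalIntegral _ _ 0, envCoeff, zero_add, Complex.real_smul]
  push_cast
  congr 1
  refine intervalIntegral.integral_congr fun x _ => ?_
  simp only [fourier_coe_apply, smul_eq_mul, circleLift, ContinuousMap.coe_mk,
    Function.Periodic.lift_coe]
  rw [mul_comm]
  congr 2
  push_cast
  ring

lemma conv_envCoeff_bound_zero {d : ℝ} (hd : 0 < d) {X : ℝ → ℝ} (hX : Continuous X)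
    (hper : Function.Periodic X d) {M : ℝ} (hM : ∀ x, |X x| ≤ M) {V : ℤ → ℂ}
    (hV : eLpNorm V 2 Measure.count ≠ ⊤) :
    (∀ p, Summable fun q => envCoeff d X (p - q) * V q) ∧
      eLpNorm (conv (envCoeff d X) V) 2 Measure.count
        ≤ ENNReal.ofReal M * eLpNorm V 2 Measure.count := by
  have : Fact (0 < d) := ⟨hd⟩
  rw [← fourierCoeff_circleLift hX hper]
  refine conv_fourierCoeff_bound _ (fun x => ?_) hV
  induction x using QuotientAddGroup.induction_on with
  | H x => simpa [circleLift] using hM x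

lemma periodic_deriv {d : ℝ} {X : ℝ → ℝ} (hper : Function.Periodic X d) :
    Function.Periodic (deriv X) d := fun x => by
  rw [← deriv_comp_add_const, funext hper]

lemma envCoeff_deriv {d : ℝ} (hd : 0 < d) {X : ℝ → ℝ} (hX : ContDiff ℝ 1 X)
    (hper : Function.Periodic X d) (k : ℤ) :
    (k : ℂ) * envCoeff d X k = (d / (2 * π) : ℝ) * -Complex.I * envCoeff d (deriv X) k := by
  set e : ℂ := -Complex.I * (2 * π / d : ℝ) * (k : ℂ) with he
  have hX' : Continuous (deriv X) := hX.continuous_deriv le_rfl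
  have hder : ∀ x, HasDerivAt (fun x : ℝ => (X x : ℂ)) ((deriv X x : ℝ) : ℂ) x := fun x =>
    ((hX.differentiable one_ne_zero x).hasDerivAt).ofReal_comp
  have hexp : ∀ x : ℝ, HasDerivAt (fun x : ℝ => Complex.exp (e * x)) (Complex.exp (e * x) * e) x :=
    fun x => by
      have := ((hasDerivAt_id (x : ℂ)).const_mul e).cexp.comp_ofReal
      simpa using this
  have hparts := intervalIntegral.integral_deriv_mul_eq_sub (a := 0) (b := d)
    (fun x _ => hder x) (fun x _ => hexp x)
    (Continuous.intervalIntegrable (by fun_prop) _ _)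
    (Continuous.intervalIntegrable (by fun_prop) _ _)
  have hdC : (d : ℂ) ≠ 0 := by exact_mod_cast hd.ne'
  have hend : Complex.exp (e * (d : ℝ)) = 1 := by
    rw [Complex.exp_eq_one_iff]
    refine ⟨-k, ?_⟩
    rw [he]
    push_cast
    field_simp
  have hXd : X d = X 0 := by simpa using hper 0
  rw [hend, hXd, intervalIntegral.integral_add
    (Continuous.intervalIntegrable (by fun_prop) _ _)
    (Continuous.intervalIntegrable (by have := hX.continuous; fun_prop) _ _)] at hparts
  simp only [← mul_assoc, intervalIntegral.integral_mul_const] at hparts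
  simp only [Complex.ofReal_zero, mul_zero, Complex.exp_zero, sub_self] at hparts
  simp only [envCoeff, ← he]
  rw [eq_neg_of_add_eq_zero_left hparts, he]
  have hπ : (π : ℂ) ≠ 0 := by exact_mod_cast Real.pi_ne_zero
  push_cast
  field_simp
  rw [Complex.I_sq]
  ring

lemma sobNorm_le {s t : ℕ} {V W : ℤ → ℂ} {C : ℝ}
    (h : ∀ p, jap p ^ t * ‖V p‖ ≤ C * (jap p ^ s * ‖W p‖)) :
    sobNorm t V ≤ ENNReal.ofReal C * sobNorm s W := by
  refine eLpNorm_le_mul_eLpNorm_of_ae_le_mul (ae_of_all _ fun p => ?_) 2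
  simpa [norm_smul, abs_of_pos (jap_pos p)] using h p

lemma sobNorm_add_le (s : ℕ) (V W : ℤ → ℂ) :
    sobNorm s (fun p => V p + W p) ≤ sobNorm s V + sobNorm s W := by
  simp only [sobNorm, smul_add]
  exact eLpNorm_add_le .of_discrete .of_discrete (by norm_num)

lemma sobNorm_mono {s t : ℕ} (h : s ≤ t) (V : ℤ → ℂ) : sobNorm s V ≤ sobNorm t V := by
  simpa using sobNorm_le (s := t) (t := s) (V := V) (W := V) (C := 1) fun p => by
    rw [one_mul]
    gcongr
    exact one_le_jap p

lemma sobNorm_succ_le (s : ℕ) (V : ℤ → ℂ) :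
    sobNorm (s + 1) V ≤ sobNorm s V + sobNorm s (fun p => p * V p) := by
  rw [sobNorm, sobNorm, sobNorm, ← eLpNorm_norm (fun p => (jap p ^ s : ℝ) • V p),
    ← eLpNorm_norm (fun p => (jap p ^ s : ℝ) • ((p : ℂ) * V p))]
  refine le_trans (eLpNorm_mono_real fun p => ?_)
    (eLpNorm_add_le .of_discrete .of_discrete (by norm_num))
  have hj : jap p ≤ 1 + |(p : ℝ)| := by
    refine Real.sqrt_le_iff.2 ⟨by positivity, ?_⟩
    nlinarith [abs_nonneg (p : ℝ), sq_abs (p : ℝ)]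
  have := jap_pos p
  simp only [Pi.add_apply, norm_smul, norm_mul, Real.norm_eq_abs, abs_pow, abs_of_pos this,
    Complex.norm_intCast]
  calc jap p ^ (s + 1) * ‖V p‖ = jap p ^ s * jap p * ‖V p‖ := by ring
    _ ≤ jap p ^ s * (1 + |(p : ℝ)|) * ‖V p‖ := by gcongr
    _ = _ := by ring

lemma sobNorm_int_mul_le (s : ℕ) (V : ℤ → ℂ) :
    sobNorm s (fun p => p * V p) ≤ sobNorm (s + 1) V := by
  simpa using sobNorm_le (s := s + 1) (t := s) (V := fun p => p * V p) (W := V) (C := 1)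
    fun p => by
      have := jap_pos p
      rw [one_mul, norm_mul, Complex.norm_intCast, pow_succ, mul_assoc]
      gcongr
      exact abs_le_jap p

/-- Multiplication by a `C^s` periodic function is bounded on `H^s`. -/
lemma conv_envCoeff_bound {d : ℝ} (hd : 0 < d) (s : ℕ) :
    ∃ c : ℝ, 0 < c ∧ ∀ (X : ℝ → ℝ) (M : ℝ), ContDiff ℝ s X → Function.Periodic X d →
      (∀ ℓ ≤ s, ∀ x, |iteratedDeriv ℓ X x| ≤ M) → ∀ V : ℤ → ℂ, sobNorm s V ≠ ⊤ →
      sobNorm s (conv (envCoeff d X) V) ≤ ENNReal.ofReal (c * M) * sobNorm s V := by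
  induction s with
  | zero =>
    refine ⟨1, one_pos, fun X M hX hper hM V hV => ?_⟩
    simp only [sobNorm, pow_zero, one_smul, one_mul] at hV ⊢
    exact (conv_envCoeff_bound_zero hd hX.continuous hper
      (fun x => by simpa using hM 0 le_rfl x) hV).2
  | succ s ih =>
    obtain ⟨c, hc, ih⟩ := ih
    refine ⟨c * (2 + d / (2 * π)), by positivity, fun X M hX hper hM V hV => ?_⟩
    have hM0 : 0 ≤ M := (abs_nonneg _).trans (hM 0 (Nat.zero_le _) 0)
    have hX1 : ContDiff ℝ 1 X := hX.of_le (by simp)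
    have hX' : ContDiff ℝ s (deriv X) := by
      push_cast at hX
      exact (contDiff_succ_iff_deriv.1 hX).2.2
    have hM' : ∀ ℓ ≤ s, ∀ x, |iteratedDeriv ℓ (deriv X) x| ≤ M := fun ℓ hℓ x => by
      rw [← iteratedDeriv_succ']
      exact hM (ℓ + 1) (by omega) x
    have hVs : sobNorm s V ≤ sobNorm (s + 1) V := sobNorm_mono (Nat.le_succ s) V
    have hVm := sobNorm_int_mul_le s V
    have hfin : ∀ W : ℤ → ℂ, sobNorm s W ≤ sobNorm (s + 1) V →
        sobNorm s W ≠ ⊤ ∧ eLpNorm W 2 Measure.count ≠ ⊤ := fun W hW => by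
      have h := ne_top_of_le_ne_top hV hW
      refine ⟨h, ?_⟩
      simpa [sobNorm] using ne_top_of_le_ne_top h (sobNorm_mono (Nat.zero_le s) W)
    have hsum' := (conv_envCoeff_bound_zero hd hX'.continuous (periodic_deriv hper)
      (fun x => by simpa using hM' 0 (Nat.zero_le _) x) (hfin V hVs).2).1
    have hsum := (conv_envCoeff_bound_zero hd hX1.continuous hper
      (fun x => by simpa using hM 0 (Nat.zero_le _) x) (hfin _ hVm).2).1
    have hleib : (fun p : ℤ => (p : ℂ) * conv (envCoeff d X) V p) = fun p =>
        ((d / (2 * π) : ℝ) * -Complex.I) * conv (envCoeff d (deriv X)) V p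
          + conv (envCoeff d X) (fun q => q * V q) p := by
      ext p
      rw [conv, conv, conv, ← tsum_mul_left, ← tsum_mul_left,
        ← ((hsum' p).mul_left _).tsum_add (hsum p)]
      refine tsum_congr fun q => ?_
      rw [← mul_assoc _ (envCoeff d (deriv X) _) (V q), ← envCoeff_deriv hd hX1 hper]
      push_cast
      ring
    have hscale : sobNorm s (fun p => ((d / (2 * π) : ℝ) * -Complex.I) *
        conv (envCoeff d (deriv X)) V p)
        ≤ ENNReal.ofReal (d / (2 * π)) * sobNorm s (conv (envCoeff d (deriv X)) V) :=
      sobNorm_le fun p => by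
        rw [norm_mul, norm_mul, norm_neg, Complex.norm_I, mul_one, Complex.norm_real,
          Real.norm_of_nonneg (by positivity)]
        exact (mul_left_comm _ _ _).le
    have hMX : ∀ ℓ ≤ s, ∀ x, |iteratedDeriv ℓ X x| ≤ M := fun ℓ hℓ => hM ℓ (by omega)
    have hXs : ContDiff ℝ s X := hX.of_le (by exact_mod_cast Nat.le_succ s)
    have h₁ := ih X M hXs hper hMX V (hfin V hVs).1
    have h₂ := ih (deriv X) M hX' (periodic_deriv hper) hM' V (hfin V hVs).1
    have h₃ := ih X M hXs hper hMX _ (hfin _ hVm).1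
    calc sobNorm (s + 1) (conv (envCoeff d X) V)
        ≤ sobNorm s (conv (envCoeff d X) V)
          + sobNorm s (fun p => p * conv (envCoeff d X) V p) := sobNorm_succ_le _ _
      _ ≤ ENNReal.ofReal (c * M) * sobNorm (s + 1) V
          + (ENNReal.ofReal (d / (2 * π)) * (ENNReal.ofReal (c * M) * sobNorm (s + 1) V)
            + ENNReal.ofReal (c * M) * sobNorm (s + 1) V) := by
        rw [hleib]
        refine add_le_add (h₁.trans (by gcongr)) ((sobNorm_add_le _ _ _).trans
          (add_le_add (hscale.trans ?_) (h₃.trans (by gcongr))))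
        gcongr
        exact h₂.trans (by gcongr)
      _ = ENNReal.ofReal (c * (2 + d / (2 * π)) * M) * sobNorm (s + 1) V := by
        rw [show c * (2 + d / (2 * π)) * M = c * M + (d / (2 * π) * (c * M) + c * M) by ring,
          ENNReal.ofReal_add (by positivity) (by positivity),
          ENNReal.ofReal_add (by positivity) (by positivity),
          ENNReal.ofReal_mul (p := d / (2 * π)) (by positivity)]
        ring

lemma abs_iteratedDeriv_le_holderNorm {d : ℝ} (hd : 0 < d) {s : ℕ} {X : ℝ → ℝ}
    (hX : ContDiff ℝ s X) (hper : Function.Periodic X d) {ℓ : ℕ} (hℓ : ℓ ≤ s) (x : ℝ) :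
    |iteratedDeriv ℓ X x| ≤ holderNorm s X := by
  have hperℓ : ∀ m, Function.Periodic (iteratedDeriv m X) d := fun m => by
    induction m with
    | zero => simpa using hper
    | succ m ih => rw [iteratedDeriv_succ]; exact periodic_deriv ih
  have hcont : Continuous (iteratedDeriv ℓ X) :=
    hX.continuous_iteratedDeriv ℓ (by exact_mod_cast hℓ)
  have hbdd : BddAbove (Set.range fun y => |iteratedDeriv ℓ X y|) := by
    obtain ⟨C, hC⟩ := isBounded_iff_forall_norm_le.1
      ((hperℓ ℓ).isBounded_of_continuous hd.ne' hcont)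
    exact ⟨C, by rintro _ ⟨y, rfl⟩; exact hC _ ⟨y, rfl⟩⟩
  exact (le_ciSup hbdd x).trans
    (le_ciSup (f := fun i : Fin (s + 1) => ⨆ y, |iteratedDeriv (i : ℕ) X y|)
      (Set.finite_range _).bddAbove ⟨ℓ, Nat.lt_succ_of_le hℓ⟩)

lemma rpow_mul_norm_sq_eq {r : ℝ} {t : ℕ} (hr : r = t) (V : ℤ → ℂ) (p : ℤ) :
    (1 + |(p : ℝ)| ^ 2) ^ r * ‖V p‖ ^ 2 = ‖(jap p ^ t : ℝ) • V p‖ ^ 2 := by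
  rw [hr, Real.rpow_natCast, sq_abs, ← jap_sq, norm_smul,
    Real.norm_of_nonneg (pow_nonneg (jap_pos p).le t)]
  ring

lemma summable_rpow_mul_norm_sq {r : ℝ} {t : ℕ} (hr : r = t) {V : ℤ → ℂ}
    (hV : sobNorm t V ≠ ⊤) :
    Summable fun p : ℤ => (1 + |(p : ℝ)| ^ 2) ^ r * ‖V p‖ ^ 2 := by
  simp only [rpow_mul_norm_sq_eq hr]
  exact eLpNorm_two_count_ne_top.1 hV

lemma sqrt_hnormSq {r : ℝ} {t : ℕ} (hr : r = t) (V : ℤ → ℂ) :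
    Real.sqrt (hnormSq r V) = (sobNorm t V).toReal := by
  simp only [hnormSq, rpow_mul_norm_sq_eq hr, sobNorm, toReal_eLpNorm_two_count]

lemma sobNorm_ne_top_of_support {V : ℤ → ℂ} (hV : ∀ p ≠ 0, V p = 0) (s : ℕ) :
    sobNorm s V ≠ ⊤ :=
  eLpNorm_two_count_ne_top.2 <|
    summable_of_ne_finset_zero (s := {0}) fun p hp => by simp [hV p (by simpa using hp)]

lemma tendsto_jap_inv : Tendsto (fun p : ℤ => (jap p)⁻¹) cofinite (𝓝 0) := by
  refine tendsto_inv_atTop_zero.comp (tendsto_atTop_mono abs_le_jap ?_)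
  have h := tendsto_norm_cocompact_atTop (E := ℤ)
  rw [cocompact_eq_cofinite] at h
  exact h.congr Int.norm_eq_abs

lemma tendsto_ofReal_jap_inv : Tendsto (fun p : ℤ => (jap p : ℂ)⁻¹) cofinite (𝓝 0) := by
  have h := (Complex.continuous_ofReal.tendsto 0).comp tendsto_jap_inv
  rw [Complex.ofReal_zero] at h
  exact h.congr fun p => Complex.ofReal_inv _

lemma tendsto_freq_sq_div (α β : ℝ) :
    Tendsto (fun p : ℤ => (α + β * p) ^ 2 / jap p ^ 2) cofinite (𝓝 (β ^ 2)) := by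
  have hp : Tendsto (fun p : ℤ => (p : ℝ) * (jap p)⁻¹ * (jap p)⁻¹) cofinite (𝓝 0) := by
    refine squeeze_zero_norm (fun p => ?_) tendsto_jap_inv
    have := jap_pos p
    rw [norm_mul, norm_mul, norm_inv, Real.norm_eq_abs, Real.norm_of_nonneg this.le,
      ← div_eq_mul_inv]
    exact mul_le_of_le_one_left (by positivity) ((div_le_one this).2 (abs_le_jap p))
  have := ((tendsto_jap_inv.pow 2).const_mul (α ^ 2 - β ^ 2)).add (hp.const_mul (2 * α * β))
    |>.const_add (β ^ 2)
  convert! this using 2 with p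
  · have := (jap_pos p).ne'
    field_simp
    rw [jap_sq]
    ring
  · simp

lemma tendsto_gamC_div (k α : ℝ) {β : ℝ} (hβ : 0 < β) :
    Tendsto (fun p : ℤ => gamC k (α + β * p) / jap p) cofinite (𝓝 (Complex.I * β)) := by
  have hlim : Tendsto (fun p : ℤ => ((α + β * p) ^ 2 - k ^ 2) / jap p ^ 2) cofinite
      (𝓝 (β ^ 2)) := by
    have := (tendsto_freq_sq_div α β).sub ((tendsto_jap_inv.pow 2).const_mul (k ^ 2))
    convert! this using 2 with p
    · ring
    · simp
  have hsqrt : Tendsto (fun p : ℤ => Real.sqrt (((α + β * p) ^ 2 - k ^ 2) / jap p ^ 2)) cofinite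
      (𝓝 β) := by
    simpa [Real.sqrt_sq hβ.le] using hlim.sqrt
  refine (((Complex.continuous_ofReal.tendsto β).comp hsqrt).const_mul Complex.I).congr' ?_
  filter_upwards [hlim.eventually (lt_mem_nhds (show 0 < β ^ 2 by positivity))] with p hp
  have hj := jap_pos p
  have : k ^ 2 < (α + β * p) ^ 2 := by
    have := (div_pos_iff_of_pos_right (by positivity)).1 hp
    linarith
  rw [gamC, if_neg (not_le.2 this), Function.comp_apply, Real.sqrt_div' _ (by positivity),
    Real.sqrt_sq hj.le]
  push_cast
  ring

lemma exists_norm_le_of_tendsto_cofinite {f : ℤ → ℂ} {L : ℂ} (h : Tendsto f cofinite (𝓝 L)) :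
    ∃ C : ℝ, 0 < C ∧ ∀ p, ‖f p‖ ≤ C := by
  obtain ⟨C, hC⟩ := h.norm.bddAbove_range_of_cofinite
  exact ⟨max C 1, by positivity, fun p => (hC ⟨p, rfl⟩).trans (le_max_left _ _)⟩

lemma tendsto_DeltaTM_div {d α ku kw k₀ X₀ τu τw : ℝ} (hd : 0 < d) (σl σn : ℂ) :
    Tendsto (fun p : ℤ => DeltaTM d α ku kw k₀ X₀ τu τw σl σn p / (jap p : ℂ) ^ 4) cofinite
      (𝓝 ((τu : ℂ) * τw * (σn / (Complex.I * k₀)) * X₀ * (Complex.I * (2 * π / d : ℝ)) *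
        (Complex.I * (2 * π / d : ℝ)) * ((2 * π / d : ℝ) : ℂ) ^ 2)) := by
  have hβ : 0 < 2 * π / d := by positivity
  have hu := tendsto_gamC_div ku α hβ
  have hw := tendsto_gamC_div kw α hβ
  have hj := tendsto_ofReal_jap_inv
  have ha := (Complex.continuous_ofReal.tendsto _).comp (tendsto_freq_sq_div α (2 * π / d))
  have h := (((hu.const_mul (-(τu : ℂ) * Complex.I)).mul (hj.pow 3)).sub
    ((hw.const_mul ((τw : ℂ) * Complex.I)).mul (hj.pow 3))).add
    ((((hu.const_mul ((τu : ℂ) * τw * (σl / (Complex.I * k₀)) * X₀)).mul hw).mul (hj.pow 2)))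
    |>.add (((hu.const_mul ((τu : ℂ) * τw * (σn / (Complex.I * k₀)) * X₀)).mul hw).mul ha)
  convert! h using 2 with p
  · have : (jap p : ℂ) ≠ 0 := by exact_mod_cast (jap_pos p).ne'
    simp only [DeltaTM, Function.comp_apply, Complex.ofReal_div, Complex.ofReal_pow]
    generalize gamC ku _ = x
    generalize gamC kw _ = y
    field_simp
  · simp

lemma exists_gamC_div_DeltaTM_bound {d α ku kw k₀ X₀ τu τw : ℝ} (hd : 0 < d) (hk₀ : 0 < k₀)
    (hτu : 0 < τu) (hτw : 0 < τw) (hX₀ : X₀ ≠ 0) (σl : ℂ) {σn : ℂ} (hσn : σn ≠ 0) (k : ℝ) :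
    ∃ C : ℝ, 0 < C ∧ ∀ p : ℤ, jap p ^ 3 * ‖gamC k (α + (2 * π / d) * p) /
      DeltaTM d α ku kw k₀ X₀ τu τw σl σn p‖ ≤ C := by
  have hβ : 0 < 2 * π / d := by positivity
  have h := (tendsto_gamC_div k α hβ).div
    (tendsto_DeltaTM_div (α := α) (ku := ku) (kw := kw) (k₀ := k₀) (X₀ := X₀) (τu := τu)
      (τw := τw) hd σl σn) (by simp [hd.ne', hk₀.ne', hτu.ne', hτw.ne', hX₀, hσn, Real.pi_ne_zero])
  obtain ⟨C, hC, hle⟩ := exists_norm_le_of_tendsto_cofinite h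
  refine ⟨C, hC, fun p => (le_of_eq ?_).trans (hle p)⟩
  have hj := jap_pos p
  simp only [Pi.div_apply, norm_div, norm_pow, Complex.norm_real, Real.norm_of_nonneg hj.le]
  field_simp

/-- The Fourier symbol of `(σ̂_loc − σ̂_nloc ∂ₓ²) τ_w J₀`. -/
noncomputable def currentSymbol (d α kw τw : ℝ) (σl σn : ℂ) (q : ℤ) : ℂ :=
  (σl + σn * ((((α + (2 * π / d) * q) ^ 2 : ℝ)) : ℂ)) * (τw : ℂ) *
    (-Complex.I * gamC kw (α + (2 * π / d) * q))

lemma exists_currentSymbol_bound {d : ℝ} (hd : 0 < d) (α kw τw : ℝ) (σl σn : ℂ) :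
    ∃ C : ℝ, 0 < C ∧ ∀ q : ℤ, ‖currentSymbol d α kw τw σl σn q‖ ≤ C * jap q ^ 3 := by
  have hβ : 0 < 2 * π / d := by positivity
  have hj := tendsto_ofReal_jap_inv
  have ha := (Complex.continuous_ofReal.tendsto _).comp (tendsto_freq_sq_div α (2 * π / d))
  obtain ⟨C, hC, hle⟩ := exists_norm_le_of_tendsto_cofinite
    (((((hj.pow 2).const_mul σl).add (ha.const_mul σn)).mul_const (τw : ℂ)).mul
      ((tendsto_gamC_div kw α hβ).const_mul (-Complex.I)))
  refine ⟨C, hC, fun q => ?_⟩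
  have hjq := jap_pos q
  rw [← div_le_iff₀ (by positivity)]
  refine (le_of_eq ?_).trans (hle q)
  have hjC : (jap q : ℂ) ≠ 0 := by exact_mod_cast hjq.ne'
  rw [← Real.norm_of_nonneg (pow_nonneg hjq.le 3), ← Complex.norm_real, ← norm_div]
  congr 1
  simp only [currentSymbol, Function.comp_apply, Complex.ofReal_div, Complex.ofReal_pow]
  generalize gamC kw _ = y
  field_simp

/-- Cramer's rule for the linear system of a single mode. -/
lemma mode_system_iff {A g h R Q x y Δ : ℂ} (hΔ : Δ ≠ 0) (hdet : -h - g * (1 + A) = Δ) :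
    (x + (-1 - A) * y = R ∧ -g * x - h * y = Q) ↔
      x = (Q * (1 + A) - h * R) / Δ ∧ y = (Q + g * R) / Δ := by
  rw [eq_div_iff hΔ, eq_div_iff hΔ]
  subst hdet
  constructor
  · rintro ⟨rfl, rfl⟩
    constructor <;> ring
  · rintro ⟨hx, hy⟩
    constructor <;> refine mul_right_cancel₀ hΔ ?_
    · linear_combination hx + (-1 - A) * hy
    · linear_combination -g * hx - h * hy

/-- One step of the recursion, solved mode by mode: the order `ℓ` term as a function of the
previous `W`. -/
noncomputable def tmStep (d α ku kw k₀ X₀ τu τw : ℝ) (σl σn : ℂ) (X₁ : ℝ → ℝ) (ℓ : ℕ)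
    (W : ℤ → ℂ) : (ℤ → ℂ) × (ℤ → ℂ) :=
  let A : ℤ → ℂ := fun p => ((X₀ : ℂ) / (Complex.I * (k₀ : ℂ))) *
    (σl + σn * ((((α + (2 * π / d) * p) ^ 2 : ℝ)) : ℂ)) * (τw : ℂ) *
    (Complex.I * gamC kw (α + (2 * π / d) * p))
  let g : ℤ → ℂ := fun p => (τu : ℂ) * Complex.I * gamC ku (α + (2 * π / d) * p)
  let h : ℤ → ℂ := fun p => (τw : ℂ) * Complex.I * gamC kw (α + (2 * π / d) * p)
  let R : ℤ → ℂ := fun p => if ℓ = 0 then (if p = 0 then (-1 : ℂ) else 0)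
    else -(1 / (Complex.I * (k₀ : ℂ))) *
      conv (envCoeff d X₁) (fun q => currentSymbol d α kw τw σl σn q * W q) p
  let Q : ℤ → ℂ := fun p =>
    if ℓ = 0 then -(τu : ℂ) * (if p = 0 then Complex.I * gamC ku α else 0) else 0
  (fun p => (Q p * (1 + A p) - h p * R p) / DeltaTM d α ku kw k₀ X₀ τu τw σl σn p,
    fun p => (Q p + g p * R p) / DeltaTM d α ku kw k₀ X₀ τu τw σl σn p)

lemma tmRec_iff {d α ku kw k₀ X₀ τu τw : ℝ} {σl σn : ℂ} {X₁ : ℝ → ℝ}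
    (hΔ : ∀ p, DeltaTM d α ku kw k₀ X₀ τu τw σl σn p ≠ 0)
    {UW : ℕ → (ℤ → ℂ) × (ℤ → ℂ)} :
    tmRec d α ku kw k₀ X₀ τu τw σl σn X₁ UW ↔
      ∀ ℓ, UW ℓ = tmStep d α ku kw k₀ X₀ τu τw σl σn X₁ ℓ (UW (ℓ - 1)).2 := by
  rw [tmRec]
  refine forall_congr' fun ℓ => ?_
  rw [Prod.ext_iff, funext_iff, funext_iff, ← forall_and]
  refine forall_congr' fun p => ?_
  refine Iff.trans ?_ (mode_system_iff (hΔ p) ?_)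
  · simp only [conv, currentSymbol, neg_mul, mul_assoc]
  · simp only [DeltaTM]
    linear_combination (-(τu : ℂ) * τw * gamC ku (α + (2 * π / d) * p) *
      gamC kw (α + (2 * π / d) * p) * (X₀ / (Complex.I * k₀)) *
      (σl + σn * ((((α + (2 * π / d) * p) ^ 2 : ℝ)) : ℂ))) * Complex.I_sq

lemma tmStep_zero (d α ku kw k₀ X₀ τu τw : ℝ) (σl σn : ℂ) (X₁ : ℝ → ℝ) (W W' : ℤ → ℂ) :
    tmStep d α ku kw k₀ X₀ τu τw σl σn X₁ 0 W = tmStep d α ku kw k₀ X₀ τu τw σl σn X₁ 0 W' := by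
  simp [tmStep]

lemma tmRec_existsUnique {d α ku kw k₀ X₀ τu τw : ℝ} {σl σn : ℂ} (X₁ : ℝ → ℝ)
    (hΔ : ∀ p, DeltaTM d α ku kw k₀ X₀ τu τw σl σn p ≠ 0) :
    ∃! UW : ℕ → (ℤ → ℂ) × (ℤ → ℂ), tmRec d α ku kw k₀ X₀ τu τw σl σn X₁ UW := by
  simp only [tmRec_iff hΔ]
  refine ⟨fun n => Nat.rec (tmStep d α ku kw k₀ X₀ τu τw σl σn X₁ 0 0)
    (fun ℓ UW => tmStep d α ku kw k₀ X₀ τu τw σl σn X₁ (ℓ + 1) UW.2) n, ?_, ?_⟩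
  · rintro (_ | ℓ)
    · exact tmStep_zero ..
    · rfl
  · intro UW hUW
    funext ℓ
    induction ℓ with
    | zero => exact (hUW 0).trans (tmStep_zero ..)
    | succ ℓ ih => rw [hUW (ℓ + 1), Nat.add_sub_cancel, ih]

/-- One step of the recursion is bounded on `H^{s+3}`, linearly in the envelope. -/
lemma exists_tmStep_succ_bound {d α ku kw k₀ X₀ τu τw : ℝ} (hd : 0 < d) (hk₀ : 0 < k₀)
    (hτu : 0 < τu) (hτw : 0 < τw) (hX₀ : X₀ ≠ 0) (s : ℕ) (σl : ℂ) {σn : ℂ} (hσn : σn ≠ 0)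
    {X₁ : ℝ → ℝ} (hX : ContDiff ℝ s X₁) (hper : Function.Periodic X₁ d) :
    ∃ C : ℝ, 0 < C ∧ ∀ (ℓ : ℕ) (W : ℤ → ℂ), sobNorm (s + 3) W ≠ ⊤ →
      sobNorm (s + 3) (tmStep d α ku kw k₀ X₀ τu τw σl σn X₁ (ℓ + 1) W).1
        ≤ ENNReal.ofReal (C * holderNorm s X₁) * sobNorm (s + 3) W ∧
      sobNorm (s + 3) (tmStep d α ku kw k₀ X₀ τu τw σl σn X₁ (ℓ + 1) W).2
        ≤ ENNReal.ofReal (C * holderNorm s X₁) * sobNorm (s + 3) W := by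
  obtain ⟨c, hc, hconv⟩ := conv_envCoeff_bound hd s
  obtain ⟨B, hB, hsymb⟩ := exists_currentSymbol_bound hd α kw τw σl σn
  obtain ⟨Eu, hEu, hu⟩ := exists_gamC_div_DeltaTM_bound (α := α) (ku := ku) (kw := kw)
    hd hk₀ hτu hτw hX₀ σl hσn ku
  obtain ⟨Ew, hEw, hw⟩ := exists_gamC_div_DeltaTM_bound (α := α) (ku := ku) (kw := kw)
    hd hk₀ hτu hτw hX₀ σl hσn kw
  have hH : 0 ≤ holderNorm s X₁ := (abs_nonneg _).trans
    (abs_iteratedDeriv_le_holderNorm hd hX hper (Nat.zero_le s) 0)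
  set E := max (τw * Ew / k₀) (τu * Eu / k₀)
  have hEpos : 0 < E := lt_max_of_lt_left (by positivity)
  refine ⟨E * c * B, by positivity, fun ℓ W hW => ?_⟩
  have hV : sobNorm s (fun q => currentSymbol d α kw τw σl σn q * W q)
      ≤ ENNReal.ofReal B * sobNorm (s + 3) W := sobNorm_le fun q => by
    have := jap_pos q
    rw [norm_mul]
    calc jap q ^ s * (‖currentSymbol d α kw τw σl σn q‖ * ‖W q‖)
        ≤ jap q ^ s * (B * jap q ^ 3 * ‖W q‖) := by gcongr; exact hsymb q
      _ = B * (jap q ^ (s + 3) * ‖W q‖) := by ring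
  have hR := (hconv X₁ _ hX hper
    (fun m hm => abs_iteratedDeriv_le_holderNorm hd hX hper hm) _
    (ne_top_of_le_ne_top (ENNReal.mul_ne_top ENNReal.ofReal_ne_top hW) hV)).trans
    (mul_le_mul_right hV _)
  set R := conv (envCoeff d X₁) (fun q => currentSymbol d α kw τw σl σn q * W q) with hRdef
  have hfinal : ∀ V : ℤ → ℂ, sobNorm (s + 3) V ≤ ENNReal.ofReal E * sobNorm s R →
      sobNorm (s + 3) V ≤ ENNReal.ofReal (E * c * B * holderNorm s X₁) * sobNorm (s + 3) W := by
    intro V hV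
    refine (hV.trans (mul_le_mul_right hR _)).trans (le_of_eq ?_)
    rw [← mul_assoc, ← mul_assoc, ← ENNReal.ofReal_mul (by positivity),
      ← ENNReal.ofReal_mul (by positivity)]
    congr 2
    ring
  have hmode : ∀ {τ k E' : ℝ}, 0 < τ → τ * E' / k₀ ≤ E →
      (∀ p : ℤ, jap p ^ 3 * ‖gamC k (α + (2 * π / d) * p) /
        DeltaTM d α ku kw k₀ X₀ τu τw σl σn p‖ ≤ E') → ∀ V : ℤ → ℂ,
      (∀ p, ‖V p‖ = τ / k₀ * ‖gamC k (α + (2 * π / d) * p) /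
        DeltaTM d α ku kw k₀ X₀ τu τw σl σn p‖ * ‖R p‖) →
      sobNorm (s + 3) V ≤ ENNReal.ofReal E * sobNorm s R := by
    intro τ k E' hτ hE' hk V hV
    refine sobNorm_le fun p => ?_
    have := jap_pos p
    rw [hV]
    calc _ = τ / k₀ * (jap p ^ 3 * ‖gamC k (α + (2 * π / d) * p) /
          DeltaTM d α ku kw k₀ X₀ τu τw σl σn p‖) * (jap p ^ s * ‖R p‖) := by ring
      _ ≤ τ / k₀ * E' * (jap p ^ s * ‖R p‖) := by gcongr; exact hk p
      _ = τ * E' / k₀ * (jap p ^ s * ‖R p‖) := by ring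
      _ ≤ E * (jap p ^ s * ‖R p‖) := by gcongr
  constructor
  · refine hfinal _ (hmode hτw (le_max_left _ _) hw _ fun p => ?_)
    simp [tmStep, ← hRdef, abs_of_pos hτw, abs_of_pos hk₀]
    ring
  · refine hfinal _ (hmode hτu (le_max_right _ _) hu _ fun p => ?_)
    simp [tmStep, ← hRdef, abs_of_pos hτu, abs_of_pos hk₀]
    ring

lemma sobNorm_tmStep_zero_ne_top (d α ku kw k₀ X₀ τu τw : ℝ) (σl σn : ℂ) (X₁ : ℝ → ℝ)
    (W : ℤ → ℂ) (t : ℕ) :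
    sobNorm t (tmStep d α ku kw k₀ X₀ τu τw σl σn X₁ 0 W).1 ≠ ⊤ ∧
      sobNorm t (tmStep d α ku kw k₀ X₀ τu τw σl σn X₁ 0 W).2 ≠ ⊤ :=
  ⟨sobNorm_ne_top_of_support (fun p hp => by simp [tmStep, hp]) t,
    sobNorm_ne_top_of_support (fun p hp => by simp [tmStep, hp]) t⟩

lemma summable_mul_pow_of_le {a : ℕ → ℝ} {K r δ : ℝ} (ha : ∀ n, 0 ≤ a n)
    (hle : ∀ n, a n ≤ K * r ^ n) (hr : 0 ≤ r) (hδ : 0 ≤ δ) (h : δ * r < 1) :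
    Summable fun n => a n * δ ^ n := by
  refine Summable.of_nonneg_of_le (fun n => mul_nonneg (ha n) (by positivity)) (fun n => ?_)
    ((summable_geometric_of_lt_one (mul_nonneg hδ hr) h).mul_left K)
  calc a n * δ ^ n ≤ K * r ^ n * δ ^ n := by gcongr; exact hle n
    _ = K * (δ * r) ^ n := by rw [mul_pow]; ring

end Helpers

/-- Theorem 4.9: under nonresonance and `X₀ ≠ 0`, for a `d`-periodic
envelope perturbation `X₁ ∈ C^s`, the TM HOPE recursion has a unique solution,
its terms lie in `H^{s+1} × H^{s+3}` and satisfy `‖U_ℓ‖_{H^{s+1}} ≤ C_U D^ℓ`,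
`‖W_ℓ‖_{H^{s+3}} ≤ C_W D^ℓ` for every `D > C|X₁|_{C^s}`; in particular the series
`Σ_ℓ U_ℓ δ^ℓ`, `Σ_ℓ W_ℓ δ^ℓ` converge for `δ·C·|X₁|_{C^s} < 1`. -/
theorem tm_hope_analyticity (d α ku kw k₀ X₀ τu τw : ℝ)
    (hd : 0 < d) (hku : 0 < ku) (hkw : 0 < kw) (hk₀ : 0 < k₀)
    (hτu : 0 < τu) (hτw : 0 < τw) (hX₀ : X₀ ≠ 0)
    (s : ℕ) (σl σn : ℂ) (hσn : σn ≠ 0)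
    (μ : ℝ) (hμ : 0 < μ)
    (hres : ∀ p : ℤ, μ ≤ ‖DeltaTM d α ku kw k₀ X₀ τu τw σl σn p‖)
    (X₁ : ℝ → ℝ) (hX₁smooth : ContDiff ℝ (s : ℕ∞) X₁)
    (hX₁per : Function.Periodic X₁ d) :
    (∃! UW : ℕ → (ℤ → ℂ) × (ℤ → ℂ), tmRec d α ku kw k₀ X₀ τu τw σl σn X₁ UW) ∧
    ∀ UW : ℕ → (ℤ → ℂ) × (ℤ → ℂ), tmRec d α ku kw k₀ X₀ τu τw σl σn X₁ UW →
      (∀ ℓ : ℕ,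
        Summable (fun p : ℤ => (1 + |(p : ℝ)| ^ 2) ^ ((s : ℝ) + 1) * ‖(UW ℓ).1 p‖ ^ 2) ∧
        Summable (fun p : ℤ => (1 + |(p : ℝ)| ^ 2) ^ ((s : ℝ) + 3) * ‖(UW ℓ).2 p‖ ^ 2)) ∧
      ∃ CU CW C : ℝ, 0 < CU ∧ 0 < CW ∧ 0 < C ∧
        (∀ D : ℝ, C * holderNorm s X₁ < D → ∀ ℓ : ℕ,
          Real.sqrt (hnormSq ((s : ℝ) + 1) (UW ℓ).1) ≤ CU * D ^ ℓ ∧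
          Real.sqrt (hnormSq ((s : ℝ) + 3) (UW ℓ).2) ≤ CW * D ^ ℓ) ∧
        ∀ δ : ℝ, 0 ≤ δ → δ * (C * holderNorm s X₁) < 1 →
          Summable (fun ℓ : ℕ => Real.sqrt (hnormSq ((s : ℝ) + 1) (UW ℓ).1) * δ ^ ℓ) ∧
          Summable (fun ℓ : ℕ => Real.sqrt (hnormSq ((s : ℝ) + 3) (UW ℓ).2) * δ ^ ℓ) := by
  have hΔ : ∀ p, DeltaTM d α ku kw k₀ X₀ τu τw σl σn p ≠ 0 := fun p =>
    norm_pos_iff.1 (hμ.trans_le (hres p))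
  refine ⟨tmRec_existsUnique X₁ hΔ, fun UW hUW => ?_⟩
  rw [tmRec_iff hΔ] at hUW
  have hX : ContDiff ℝ s X₁ := by exact_mod_cast hX₁smooth
  have hr1 : (s : ℝ) + 1 = (s + 1 : ℕ) := by push_cast; rfl
  have hr3 : (s : ℝ) + 3 = (s + 3 : ℕ) := by push_cast; rfl
  obtain ⟨C, hC, hstep⟩ := exists_tmStep_succ_bound (α := α) (ku := ku) (kw := kw)
    hd hk₀ hτu hτw hX₀ s σl hσn hX hX₁per
  have hH : 0 ≤ C * holderNorm s X₁ := mul_nonneg hC.le ((abs_nonneg _).trans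
    (abs_iteratedDeriv_le_holderNorm hd hX hX₁per (Nat.zero_le s) 0))
  set r := C * holderNorm s X₁
  have hU0 : sobNorm (s + 3) (UW 0).1 ≠ ⊤ := by
    rw [hUW 0]; exact (sobNorm_tmStep_zero_ne_top ..).1
  have hW0 : sobNorm (s + 3) (UW 0).2 ≠ ⊤ := by
    rw [hUW 0]; exact (sobNorm_tmStep_zero_ne_top ..).2
  have hWfin : ∀ ℓ, sobNorm (s + 3) (UW ℓ).2 ≠ ⊤ := fun ℓ => by
    induction ℓ with
    | zero => exact hW0
    | succ ℓ ih =>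
      rw [hUW (ℓ + 1)]
      exact ne_top_of_le_ne_top (ENNReal.mul_ne_top ENNReal.ofReal_ne_top ih) (hstep ℓ _ ih).2
  have hUfin : ∀ ℓ, sobNorm (s + 3) (UW ℓ).1 ≠ ⊤ := fun ℓ => by
    cases ℓ with
    | zero => exact hU0
    | succ ℓ =>
      rw [hUW (ℓ + 1)]
      exact ne_top_of_le_ne_top (ENNReal.mul_ne_top ENNReal.ofReal_ne_top (hWfin ℓ))
        (hstep ℓ _ (hWfin ℓ)).1
  have hWsucc : ∀ ℓ, (sobNorm (s + 3) (UW (ℓ + 1)).2).toReal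
      ≤ r * (sobNorm (s + 3) (UW ℓ).2).toReal := fun ℓ => by
    rw [hUW (ℓ + 1), ← ENNReal.toReal_ofReal hH, ← ENNReal.toReal_mul]
    exact ENNReal.toReal_mono (ENNReal.mul_ne_top ENNReal.ofReal_ne_top (hWfin ℓ))
      (hstep ℓ _ (hWfin ℓ)).2
  have hUsucc : ∀ ℓ, (sobNorm (s + 3) (UW (ℓ + 1)).1).toReal
      ≤ r * (sobNorm (s + 3) (UW ℓ).2).toReal := fun ℓ => by
    rw [hUW (ℓ + 1), ← ENNReal.toReal_ofReal hH, ← ENNReal.toReal_mul]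
    exact ENNReal.toReal_mono (ENNReal.mul_ne_top ENNReal.ofReal_ne_top (hWfin ℓ))
      (hstep ℓ _ (hWfin ℓ)).1
  set K := max (sobNorm (s + 3) (UW 0).1).toReal (sobNorm (s + 3) (UW 0).2).toReal + 1
  have hKpos : 0 < K := by positivity
  have hWle : ∀ ℓ, (sobNorm (s + 3) (UW ℓ).2).toReal ≤ K * r ^ ℓ := fun ℓ => by
    induction ℓ with
    | zero => simpa using (le_max_right _ _).trans (lt_add_one _).le
    | succ ℓ ih =>
      calc _ ≤ r * (K * r ^ ℓ) := (hWsucc ℓ).trans (by gcongr)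
        _ = K * r ^ (ℓ + 1) := by ring
  have hUle : ∀ ℓ, (sobNorm (s + 1) (UW ℓ).1).toReal ≤ K * r ^ ℓ := fun ℓ => by
    refine (ENNReal.toReal_mono (hUfin ℓ) (sobNorm_mono (by omega) _)).trans ?_
    cases ℓ with
    | zero => simpa using (le_max_left _ _).trans (lt_add_one _).le
    | succ ℓ =>
      calc _ ≤ r * (K * r ^ ℓ) := (hUsucc ℓ).trans (by gcongr; exact hWle ℓ)
        _ = K * r ^ (ℓ + 1) := by ring
  refine ⟨fun ℓ => ⟨summable_rpow_mul_norm_sq hr1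
    (ne_top_of_le_ne_top (hUfin ℓ) (sobNorm_mono (by omega) _)),
    summable_rpow_mul_norm_sq hr3 (hWfin ℓ)⟩, K, K, C, hKpos, hKpos, hC, fun D hD ℓ => ?_,
    fun δ hδ hδr => ?_⟩
  · rw [sqrt_hnormSq hr1, sqrt_hnormSq hr3]
    have hpow : K * r ^ ℓ ≤ K * D ^ ℓ := by gcongr
    exact ⟨(hUle ℓ).trans hpow, (hWle ℓ).trans hpow⟩
  · simp only [sqrt_hnormSq hr1, sqrt_hnormSq hr3]
    exact ⟨summable_mul_pow_of_le (fun _ => ENNReal.toReal_nonneg) hUle hH hδ hδr,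
      summable_mul_pow_of_le (fun _ => ENNReal.toReal_nonneg) hWle hH hδ hδr⟩
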